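/- Duality theorem: Let 𝒢 and 𝒦 be groupoids with 𝒢₀ and 𝒦₀ finite, A a unital 𝒢-graded algebra, and X a finite (𝒢_α,𝒦_β)-set that is split for both actions. If the action of 𝒦 on X is fully faithful, then there is an isomorphism of algebras (A #_α^𝒢 X) *_γ 𝒦 ≅ End((A #_α^𝒢 X)_{A #_λ^𝒢 O^𝒦}), where γ is the induced action of 𝒦 on A #_α^𝒢 X, O^𝒦 is the set of 𝒦-orbits of X with its induced 𝒢-action λ, A #_λ^𝒢 O^𝒦 acts on A #_α^𝒢 X on the right through the embedding φ*, and End denotes the algebra of endomorphisms of A #_α^𝒢 X as a right A #_λ^𝒢 O^𝒦-module. -/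

import Mathlib

open scoped Classical

noncomputable section

universe u v w

/-- A groupoid, presented as a set of morphisms with partially defined
composition.  `s g` is the domain (source) identity `d(g)`, `t g` the range
(target) identity `r(g)`; `mul g h` is the composite `gh`, meaningful when
`s g = t h`. -/
structure Gpd (G : Type u) where
  s : G → G
  t : G → G
  inv : G → G
  mul : G → G → G
  s_s : ∀ g, s (s g) = s g
  t_s : ∀ g, t (s g) = s g
  s_t : ∀ g, s (t g) = t g
  t_t : ∀ g, t (t g) = t g
  s_mul : ∀ g h, s g = t h → s (mul g h) = s h
  t_mul : ∀ g h, s g = t h → t (mul g h) = t g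
  mul_assoc : ∀ g h l, s g = t h → s h = t l → mul (mul g h) l = mul g (mul h l)
  mul_src : ∀ g, mul g (s g) = g
  tgt_mul : ∀ g, mul (t g) g = g
  s_inv : ∀ g, s (inv g) = t g
  t_inv : ∀ g, t (inv g) = s g
  inv_mul : ∀ g, mul (inv g) g = s g
  mul_inv : ∀ g, mul g (inv g) = t g

namespace Gpd

variable {G : Type u}

/-- `e` is an object (identity) of the groupoid. -/
def obj (𝒢 : Gpd G) (e : G) : Prop := 𝒢.s e = e

/-- The set `𝒢₀` of objects of the groupoid. -/
def Objs (𝒢 : Gpd G) : Set G := {e | 𝒢.obj e}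

end Gpd

/-- An action `α = (X_g, α_g)` of a groupoid `𝒢` on a set `X`:
`car g` is the subset `X_g` and `act g` restricts to the bijection
`α_g : X_{g⁻¹} → X_g`. -/
structure GpdSetAction {G : Type u} (𝒢 : Gpd G) (X : Type v) where
  car : G → Set X
  act : G → X → X
  car_t : ∀ g, car g = car (𝒢.t g)
  bijOn : ∀ g, Set.BijOn (act g) (car (𝒢.inv g)) (car g)
  act_id : ∀ e, 𝒢.obj e → ∀ x ∈ car e, act e x = x
  act_mul : ∀ g h, 𝒢.s g = 𝒢.t h → ∀ x ∈ car (𝒢.inv h),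
    act g (act h x) = act (𝒢.mul g h) x

/-- `X` is a split `𝒢`-set: `X` is the disjoint union of the `X_e`, `e ∈ 𝒢₀`. -/
def GpdSetAction.Split {G : Type u} {𝒢 : Gpd G} {X : Type v} (α : GpdSetAction 𝒢 X) : Prop :=
  ∀ x : X, ∃! e : G, 𝒢.obj e ∧ x ∈ α.car e

/-- The action is fully faithful: if `α_g` fixes some `x ∈ X_g ∩ X_{g⁻¹}`
then `g` is an identity. -/
def GpdSetAction.FullyFaithful {G : Type u} {𝒢 : Gpd G} {X : Type v}
    (α : GpdSetAction 𝒢 X) : Prop :=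
  ∀ g x, x ∈ α.car g ∩ α.car (𝒢.inv g) → α.act g x = x → 𝒢.obj g

/-- A `𝒢`-grading of the `k`-algebra `A`:  `A = ⊕_{g ∈ 𝒢} A_g` with
`A_g A_h ⊆ A_{gh}` for composable `g, h` and `A_g A_h = 0` otherwise. -/
structure GpdGrading {G : Type u} (𝒢 : Gpd G) (k : Type v) (A : Type w)
    [Field k] [Ring A] [Algebra k A] where
  comp : G → Submodule k A
  internal : DirectSum.IsInternal comp
  mul_mem : ∀ g h, 𝒢.s g = 𝒢.t h → ∀ a ∈ comp g, ∀ b ∈ comp h, a * b ∈ comp (𝒢.mul g h)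
  mul_eq_zero : ∀ g h, 𝒢.s g ≠ 𝒢.t h → ∀ a ∈ comp g, ∀ b ∈ comp h, a * b = 0

/-- The homogeneous component of degree `g` of `a ∈ A`. -/
noncomputable def GpdGrading.proj {G : Type u} {𝒢 : Gpd G} {k : Type v} {A : Type w}
    [Field k] [Ring A] [Algebra k A] (𝒜 : GpdGrading 𝒢 k A) (g : G) (a : A) : A :=
  ((Equiv.ofBijective _ 𝒜.internal).symm a g : A)

/-- `one : G → A` is a family of local units for the grading: each `one e`
(`e ∈ 𝒢₀`) is an identity element of `A_e` and `1_A = Σ_{e ∈ 𝒢₀} 1_e`. -/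
def IsIdFamily {G : Type u} {𝒢 : Gpd G} {k : Type v} {A : Type w}
    [Field k] [Ring A] [Algebra k A] (𝒜 : GpdGrading 𝒢 k A) (one : G → A) : Prop :=
  (∀ e, 𝒢.obj e → one e ∈ 𝒜.comp e ∧ ∀ a ∈ 𝒜.comp e, one e * a = a ∧ a * one e = a) ∧
  (1 : A) = ∑ᶠ e ∈ 𝒢.Objs, one e

/-- The multiplication of the smash product `A #_α^𝒢 X`, defined on the
ambient space of formal sums `Σ a_{(g,x)} δ_{(g,x)}`:
`(a δ_{(g,x)}) (b δ_{(h,y)}) = (a b) δ_{(gh, y)}` when `d(g) = r(h)` and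
`α_h(y) = x`, and `0` otherwise. -/
noncomputable def smashMul {G : Type u} {𝒢 : Gpd G} {X : Type v} {A : Type w} [Ring A]
    (α : GpdSetAction 𝒢 X) (f₁ f₂ : (G × X) →₀ A) : (G × X) →₀ A :=
  f₁.sum fun p a => f₂.sum fun q b =>
    if 𝒢.s p.1 = 𝒢.t q.1 ∧ α.act q.1 q.2 = p.2
    then Finsupp.single (𝒢.mul p.1 q.1, q.2) (a * b) else 0

/-- The underlying set of the smash product `A #_α^𝒢 X = ⊕_{g} ⊕_{x ∈ X_{d(g)}} A_g δ_x`: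
those formal sums whose `(g,x)`-coefficient lies in `A_g`, supported on pairs
with `x ∈ X_{d(g)}`. -/
def smashSet {G : Type u} {𝒢 : Gpd G} {X : Type v} {k : Type*} {A : Type w}
    [Field k] [Ring A] [Algebra k A]
    (α : GpdSetAction 𝒢 X) (𝒜 : GpdGrading 𝒢 k A) : Set ((G × X) →₀ A) :=
  {f | ∀ p : G × X, f p ∈ 𝒜.comp p.1 ∧ (f p ≠ 0 → p.2 ∈ α.car (𝒢.s p.1))}

/-- The identity element `Σ_{e ∈ 𝒢₀} Σ_{x ∈ X_e} 1_e δ_x` of the smash product. -/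
noncomputable def smashOne {G : Type u} {𝒢 : Gpd G} {X : Type v} {A : Type w} [Ring A]
    (α : GpdSetAction 𝒢 X) (one : G → A) : (G × X) →₀ A :=
  ∑ᶠ e ∈ 𝒢.Objs, ∑ᶠ x ∈ α.car e, Finsupp.single ((e, x) : G × X) (one e)

/-- `X` is a `(𝒢_α, 𝒦_β)`-set:  each `Y_k` is `α`-invariant, each `X_g` is
`β`-invariant, and the two actions commute. -/
structure GKCompat {G : Type u} {K : Type*} {𝒢 : Gpd G} {𝒦 : Gpd K} {X : Type v}
    (α : GpdSetAction 𝒢 X) (β : GpdSetAction 𝒦 X) : Prop where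
  alpha_inv : ∀ g κ, α.act g '' (α.car (𝒢.inv g) ∩ β.car κ) ⊆ α.car g ∩ β.car κ
  beta_inv : ∀ g κ, β.act κ '' (α.car g ∩ β.car (𝒦.inv κ)) ⊆ α.car g ∩ β.car κ
  comm : ∀ g κ x, x ∈ α.car (𝒢.inv g) ∩ β.car (𝒦.inv κ) →
    α.act g (β.act κ x) = β.act κ (α.act g x)

/-- The ideal `E_k = A #^𝒢_{θ^k} Y_k = ⊕_g ⊕_{x ∈ Y_k ∩ X_{d(g)}} A_g δ_x`
of the smash product `A #_α^𝒢 X`. -/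
def Eset {G : Type u} {K : Type*} {𝒢 : Gpd G} {𝒦 : Gpd K} {X : Type v}
    {k : Type*} {A : Type w} [Field k] [Ring A] [Algebra k A]
    (α : GpdSetAction 𝒢 X) (β : GpdSetAction 𝒦 X) (𝒜 : GpdGrading 𝒢 k A)
    (κ : K) : Set ((G × X) →₀ A) :=
  {f | f ∈ smashSet α 𝒜 ∧ ∀ p : G × X, f p ≠ 0 → p.2 ∈ β.car κ}

/-- The map `γ_k : E_{k⁻¹} → E_k`, `γ_k(a_g δ_y) = a_g δ_{β_k(y)}`. -/
noncomputable def gammaAct {G : Type u} {K : Type*} {𝒦 : Gpd K} {X : Type v} {A : Type w}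
    [Ring A] (β : GpdSetAction 𝒦 X) (κ : K) (f : (G × X) →₀ A) : (G × X) →₀ A :=
  f.sum fun p a =>
    if p.2 ∈ β.car (𝒦.inv κ) then Finsupp.single ((p.1, β.act κ p.2) : G × X) a else 0

/-- The identity element `𝟏_k = Σ_{e ∈ 𝒢₀} Σ_{x ∈ Y_k ∩ X_e} 1_e δ_x` of `E_k`. -/
noncomputable def OneE {G : Type u} {K : Type*} {𝒢 : Gpd G} {𝒦 : Gpd K} {X : Type v}
    {A : Type w} [Ring A]
    (α : GpdSetAction 𝒢 X) (β : GpdSetAction 𝒦 X) (one : G → A) (κ : K) : (G × X) →₀ A :=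
  ∑ᶠ e ∈ 𝒢.Objs, ∑ᶠ x ∈ (β.car κ ∩ α.car e), Finsupp.single ((e, x) : G × X) (one e)

/-- The `𝒦`-orbit `o(x) = {β_k(x) : k ∈ D_p}` of `x ∈ Y_p`. -/
def orbit {K : Type*} {𝒦 : Gpd K} {X : Type v} (β : GpdSetAction 𝒦 X) (x : X) : Set X :=
  {y | ∃ κ, x ∈ β.car (𝒦.inv κ) ∧ β.act κ x = y}

/-- The set `O^𝒦` of `𝒦`-orbits of `X`. -/
abbrev OrbT {K : Type*} {𝒦 : Gpd K} {X : Type v} (β : GpdSetAction 𝒦 X) : Type v :=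
  {o : Set X // ∃ x, orbit β x = o}

/-- The orbit map `φ : X → O^𝒦`, `φ(x) = o(x)`. -/
def orbMap {K : Type*} {𝒦 : Gpd K} {X : Type v} (β : GpdSetAction 𝒦 X) (x : X) : OrbT β :=
  ⟨orbit β x, ⟨x, rfl⟩⟩

/-- The monomorphism `φ* : A #_λ^𝒢 O^𝒦 → A #_α^𝒢 X` induced by the orbit map,
`φ*(a_g δ_{o(x)}) = Σ_{y ∈ X_{d(g)}, o(y) = o(x)} a_g δ_y`. -/
noncomputable def phiStar {G : Type u} {K : Type*} {𝒢 : Gpd G} {𝒦 : Gpd K} {X : Type v}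
    {A : Type w} [Ring A] (α : GpdSetAction 𝒢 X) (β : GpdSetAction 𝒦 X)
    (f : (G × OrbT β) →₀ A) : (G × X) →₀ A :=
  f.sum fun p a =>
    ∑ᶠ y ∈ {y | y ∈ α.car (𝒢.s p.1) ∧ orbit β y = (p.2 : Set X)},
      Finsupp.single ((p.1, y) : G × X) a

/-- The subalgebra of invariants `(A #_α^𝒢 X)^γ`:  all `b` in the smash
product with `γ_k(b 𝟏_{k⁻¹}) = b 𝟏_k` for every `k ∈ 𝒦`. -/
noncomputable def invariantSet {G : Type u} {K : Type*} {𝒢 : Gpd G} {𝒦 : Gpd K} {X : Type v}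
    {k : Type*} {A : Type w} [Field k] [Ring A] [Algebra k A]
    (α : GpdSetAction 𝒢 X) (β : GpdSetAction 𝒦 X) (𝒜 : GpdGrading 𝒢 k A)
    (one : G → A) : Set ((G × X) →₀ A) :=
  {f | f ∈ smashSet α 𝒜 ∧ ∀ κ : K,
    gammaAct β κ (smashMul α f (OneE α β one (𝒦.inv κ))) = smashMul α f (OneE α β one κ)}

/-- The multiplication of the skew groupoid ring `(A #_α^𝒢 X) *_γ 𝒦`,
given on formal sums `Σ_k x_k δ_k` (with `x_k ∈ E_k`) by
`(x δ_k)(y δ_l) = x γ_k(y) δ_{kl}` when `d(k) = r(l)` and `0` otherwise. -/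
noncomputable def skewMul {G : Type u} {K : Type*} {𝒢 : Gpd G} {𝒦 : Gpd K} {X : Type v}
    {A : Type w} [Ring A] (α : GpdSetAction 𝒢 X) (β : GpdSetAction 𝒦 X)
    (F₁ F₂ : K →₀ ((G × X) →₀ A)) : K →₀ ((G × X) →₀ A) :=
  F₁.sum fun κ x => F₂.sum fun l y =>
    if 𝒦.s κ = 𝒦.t l then Finsupp.single (𝒦.mul κ l) (smashMul α x (gammaAct β κ y)) else 0

/-- The underlying set of the skew groupoid ring
`(A #_α^𝒢 X) *_γ 𝒦 = ⊕_{k ∈ 𝒦} E_k δ_k`. -/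
def skewSet {G : Type u} {K : Type*} {𝒢 : Gpd G} {𝒦 : Gpd K} {X : Type v}
    {k : Type*} {A : Type w} [Field k] [Ring A] [Algebra k A]
    (α : GpdSetAction 𝒢 X) (β : GpdSetAction 𝒦 X) (𝒜 : GpdGrading 𝒢 k A) :
    Set (K →₀ ((G × X) →₀ A)) :=
  {F | ∀ κ, F κ ∈ Eset α β 𝒜 κ}

/-- `F` represents an endomorphism of `A #_α^𝒢 X` as a right
`A #_λ^𝒢 O^𝒦`-module (the right action being given through the embedding
`φ*`). -/
def IsRModEnd {G : Type u} {K : Type*} {𝒢 : Gpd G} {𝒦 : Gpd K} {X : Type v}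
    {k : Type*} {A : Type w} [Field k] [Ring A] [Algebra k A]
    (α : GpdSetAction 𝒢 X) (β : GpdSetAction 𝒦 X) (𝒜 : GpdGrading 𝒢 k A)
    (lam : GpdSetAction 𝒢 (OrbT β))
    (F : ((G × X) →₀ A) → ((G × X) →₀ A)) : Prop :=
  (∀ f ∈ smashSet α 𝒜, F f ∈ smashSet α 𝒜) ∧
  (∀ f₁ ∈ smashSet α 𝒜, ∀ f₂ ∈ smashSet α 𝒜, F (f₁ + f₂) = F f₁ + F f₂) ∧
  (∀ (c : k), ∀ f ∈ smashSet α 𝒜, F (c • f) = c • F f) ∧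
  (∀ f ∈ smashSet α 𝒜, ∀ w ∈ smashSet lam 𝒜,
    F (smashMul α f (phiStar α β w)) = smashMul α (F f) (phiStar α β w))

/-- There is an isomorphism of algebras
`(A #_α^𝒢 X) *_γ 𝒦 ≅ End((A #_α^𝒢 X)_{A #_λ^𝒢 O^𝒦})`. -/
def SmashDuality {G : Type u} {K : Type*} {𝒢 : Gpd G} {𝒦 : Gpd K} {X : Type v}
    (k : Type*) {A : Type w} [Field k] [Ring A] [Algebra k A]
    (α : GpdSetAction 𝒢 X) (β : GpdSetAction 𝒦 X) (𝒜 : GpdGrading 𝒢 k A)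
    (lam : GpdSetAction 𝒢 (OrbT β)) : Prop :=
  ∃ Ψ : (K →₀ ((G × X) →₀ A)) → ((G × X) →₀ A) → ((G × X) →₀ A),
    -- Ψ maps the skew groupoid ring into the endomorphism algebra
    (∀ F ∈ skewSet α β 𝒜, IsRModEnd α β 𝒜 lam (Ψ F)) ∧
    -- Ψ is k-linear
    (∀ F₁ ∈ skewSet α β 𝒜, ∀ F₂ ∈ skewSet α β 𝒜, ∀ f ∈ smashSet α 𝒜,
      Ψ (F₁ + F₂) f = Ψ F₁ f + Ψ F₂ f) ∧
    (∀ (c : k), ∀ F ∈ skewSet α β 𝒜, ∀ f ∈ smashSet α 𝒜, Ψ (c • F) f = c • Ψ F f) ∧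
    -- Ψ is multiplicative (composition of endomorphisms)
    (∀ F₁ ∈ skewSet α β 𝒜, ∀ F₂ ∈ skewSet α β 𝒜, ∀ f ∈ smashSet α 𝒜,
      Ψ (skewMul α β F₁ F₂) f = Ψ F₁ (Ψ F₂ f)) ∧
    -- Ψ is injective
    (∀ F₁ ∈ skewSet α β 𝒜, ∀ F₂ ∈ skewSet α β 𝒜,
      (∀ f ∈ smashSet α 𝒜, Ψ F₁ f = Ψ F₂ f) → F₁ = F₂) ∧
    -- Ψ is surjective onto the endomorphism algebra
    (∀ F : ((G × X) →₀ A) → ((G × X) →₀ A), IsRModEnd α β 𝒜 lam F →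
      ∃ Fs ∈ skewSet α β 𝒜, ∀ f ∈ smashSet α 𝒜, Ψ Fs f = F f)

section Helpers

namespace Gpd

variable {G : Type u} (𝒢 : Gpd G)

theorem obj_s (g : G) : 𝒢.obj (𝒢.s g) := 𝒢.s_s g

theorem obj_t (g : G) : 𝒢.obj (𝒢.t g) := 𝒢.s_t g

theorem t_of_obj {e : G} (h : 𝒢.obj e) : 𝒢.t e = e := by
  have h' : 𝒢.s e = e := h
  rw [← h', 𝒢.t_s]

theorem inv_inv' (g : G) : 𝒢.inv (𝒢.inv g) = g := by
  have h1 : 𝒢.s (𝒢.inv (𝒢.inv g)) = 𝒢.s g := by rw [𝒢.s_inv, 𝒢.t_inv]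
  have := 𝒢.mul_assoc (𝒢.inv (𝒢.inv g)) (𝒢.inv g) g (𝒢.s_inv _) (𝒢.s_inv _)
  rw [𝒢.inv_mul, 𝒢.inv_mul, 𝒢.s_inv, 𝒢.tgt_mul, ← h1, 𝒢.mul_src] at this
  exact this.symm

theorem eq_t_of_mul_eq {g h : G} (hs : 𝒢.s g = 𝒢.t h) (hm : 𝒢.mul g h = h) : g = 𝒢.t h := by
  have := 𝒢.mul_assoc g h (𝒢.inv h) hs (𝒢.t_inv h).symm
  rw [hm, 𝒢.mul_inv, ← hs, 𝒢.mul_src, hs] at this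
  exact this.symm

theorem eq_s_of_mul_eq {g h : G} (hs : 𝒢.s g = 𝒢.t h) (hm : 𝒢.mul g h = g) : h = 𝒢.s g := by
  have := 𝒢.mul_assoc (𝒢.inv g) g h (𝒢.s_inv g) hs
  rw [hm, 𝒢.inv_mul, hs, 𝒢.tgt_mul] at this
  rw [hs]; exact this

theorem eq_of_inv_mul_obj {g h : G} (hs : 𝒢.t g = 𝒢.t h) (ho : 𝒢.obj (𝒢.mul (𝒢.inv g) h)) :
    g = h := by
  have c1 : 𝒢.s (𝒢.inv g) = 𝒢.t h := by rw [𝒢.s_inv, hs]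
  have h1 : 𝒢.mul (𝒢.inv g) h = 𝒢.s g := by
    have := 𝒢.t_of_obj ho
    rw [𝒢.t_mul _ _ c1, 𝒢.t_inv] at this
    exact this.symm
  have := 𝒢.mul_assoc g (𝒢.inv g) h (𝒢.t_inv g).symm c1
  rw [h1, 𝒢.mul_src, 𝒢.mul_inv, hs, 𝒢.tgt_mul] at this
  exact this.symm

end Gpd

namespace GpdSetAction

variable {G : Type u} {𝒢 : Gpd G} {X : Type v} (α : GpdSetAction 𝒢 X)

theorem car_inv (g : G) : α.car (𝒢.inv g) = α.car (𝒢.s g) := by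
  rw [α.car_t, 𝒢.t_inv]

theorem act_mem {g : G} {x : X} (hx : x ∈ α.car (𝒢.s g)) : α.act g x ∈ α.car (𝒢.t g) := by
  rw [← α.car_t]
  exact (α.bijOn g).mapsTo (by rwa [α.car_inv])

theorem act_mem_inv {g : G} {x : X} (hx : x ∈ α.car (𝒢.t g)) :
    α.act (𝒢.inv g) x ∈ α.car (𝒢.s g) := by
  have := α.act_mem (g := 𝒢.inv g) (x := x) (by rwa [𝒢.s_inv])
  rwa [𝒢.t_inv] at this

theorem act_inj {g : G} {x y : X} (hx : x ∈ α.car (𝒢.s g)) (hy : y ∈ α.car (𝒢.s g))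
    (h : α.act g x = α.act g y) : x = y :=
  (α.bijOn g).injOn (by rwa [α.car_inv]) (by rwa [α.car_inv]) h

theorem act_comp {g h : G} (hs : 𝒢.s g = 𝒢.t h) {x : X} (hx : x ∈ α.car (𝒢.s h)) :
    α.act g (α.act h x) = α.act (𝒢.mul g h) x :=
  α.act_mul g h hs x (by rwa [α.car_inv])

theorem act_inv_act {g : G} {x : X} (hx : x ∈ α.car (𝒢.s g)) :
    α.act (𝒢.inv g) (α.act g x) = x := by
  rw [α.act_comp (𝒢.s_inv g) hx, 𝒢.inv_mul, α.act_id _ (𝒢.obj_s g) _ hx]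

theorem act_act_inv {g : G} {x : X} (hx : x ∈ α.car (𝒢.t g)) :
    α.act g (α.act (𝒢.inv g) x) = x := by
  rw [α.act_comp (𝒢.t_inv g).symm (by rwa [𝒢.s_inv]), 𝒢.mul_inv, α.act_id _ (𝒢.obj_t g) _ hx]

theorem Split.eq {α : GpdSetAction 𝒢 X} (h : α.Split) {e f : G} (he : 𝒢.obj e) (hf : 𝒢.obj f)
    {x : X} (hxe : x ∈ α.car e) (hxf : x ∈ α.car f) : e = f :=
  (h x).unique ⟨he, hxe⟩ ⟨hf, hxf⟩

/-- The object over which `x` lies. -/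
def ob {α : GpdSetAction 𝒢 X} (h : α.Split) (x : X) : G := (h x).choose

theorem ob_obj {α : GpdSetAction 𝒢 X} (h : α.Split) (x : X) : 𝒢.obj (ob h x) :=
  (h x).choose_spec.1.1

theorem mem_ob {α : GpdSetAction 𝒢 X} (h : α.Split) (x : X) : x ∈ α.car (ob h x) :=
  (h x).choose_spec.1.2

theorem ob_eq {α : GpdSetAction 𝒢 X} (h : α.Split) {x : X} {e : G} (he : 𝒢.obj e)
    (hx : x ∈ α.car e) : ob h x = e :=
  h.eq (ob_obj h x) he (mem_ob h x) hx

theorem FullyFaithful.eq {α : GpdSetAction 𝒢 X} (hff : α.FullyFaithful) (h : α.Split)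
    {g l : G} {x : X} (hx : x ∈ α.car (𝒢.s g)) (hx' : x ∈ α.car (𝒢.s l))
    (he : α.act g x = α.act l x) : g = l := by
  have hs : 𝒢.s g = 𝒢.s l := h.eq (𝒢.obj_s g) (𝒢.obj_s l) hx hx'
  have ht : 𝒢.t g = 𝒢.t l := h.eq (𝒢.obj_t g) (𝒢.obj_t l) (α.act_mem hx) (he ▸ α.act_mem hx')
  apply 𝒢.eq_of_inv_mul_obj ht
  have c1 : 𝒢.s (𝒢.inv g) = 𝒢.t l := by rw [𝒢.s_inv, ht]
  apply hff _ x
  · rw [α.car_inv, α.car_t, 𝒢.s_mul _ _ c1, 𝒢.t_mul _ _ c1, 𝒢.t_inv]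
    exact ⟨hx, hx'⟩
  · rw [← α.act_comp c1 hx', ← he, α.act_inv_act hx]

theorem FullyFaithful.eq' {α : GpdSetAction 𝒢 X} (hff : α.FullyFaithful) (h : α.Split)
    {g l : G} {x : X} (hx : x ∈ α.car (𝒢.t g)) (hx' : x ∈ α.car (𝒢.t l))
    (he : α.act (𝒢.inv g) x = α.act (𝒢.inv l) x) : g = l := by
  have := FullyFaithful.eq hff h (g := 𝒢.inv g) (l := 𝒢.inv l) (x := x)
    (by rwa [𝒢.s_inv]) (by rwa [𝒢.s_inv]) he
  rw [← 𝒢.inv_inv' g, this, 𝒢.inv_inv']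

theorem finite_nonempty {α : GpdSetAction 𝒢 X} (hff : α.FullyFaithful) (h : α.Split)
    [Finite X] : {g | (α.car g).Nonempty}.Finite := by
  have : {g | (α.car g).Nonempty} ⊆
      ⋃ x : X, ⋃ y : X, {g | x ∈ α.car g ∧ α.act (𝒢.inv g) x = y} := by
    rintro g ⟨x, hx⟩
    simp only [Set.mem_iUnion]
    exact ⟨x, _, hx, rfl⟩
  refine Set.Finite.subset ?_ this
  refine Set.finite_iUnion fun x => Set.finite_iUnion fun y => Set.Subsingleton.finite ?_
  rintro g ⟨hg, hg'⟩ l ⟨hl, hl'⟩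
  rw [α.car_t] at hg hl
  exact hff.eq' h hg hl (hg'.trans hl'.symm)

end GpdSetAction

theorem GpdGrading.exists_one {G : Type u} {𝒢 : Gpd G} {k : Type*} {A : Type w}
    [Field k] [Ring A] [Algebra k A] (𝒜 : GpdGrading 𝒢 k A) :
    ∃ one : G → A, (∀ e, one e ∈ 𝒜.comp e) ∧
      ∀ h, ∀ a ∈ 𝒜.comp h, one (𝒢.t h) * a = a ∧ a * one (𝒢.s h) = a := by
  let _ := 𝒜.internal.chooseDecomposition
  refine ⟨fun e => (DirectSum.decompose 𝒜.comp (1 : A) e : A), fun e => SetLike.coe_mem _, ?_⟩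
  intro h a ha
  have h1 := DirectSum.sum_support_decompose 𝒜.comp (1 : A)
  constructor
  · have e1 : a = ∑ i ∈ (DirectSum.decompose 𝒜.comp (1 : A)).support,
        (DirectSum.decompose 𝒜.comp (1 : A) i : A) * a := by
      rw [← Finset.sum_mul, h1, one_mul]
    have e2 : ((DirectSum.decompose 𝒜.comp a) h : A) =
      ∑ i ∈ (DirectSum.decompose 𝒜.comp (1 : A)).support,
        ((DirectSum.decompose 𝒜.comp ((DirectSum.decompose 𝒜.comp (1 : A) i : A) * a)) h : A) := by
      conv_lhs => rw [e1]
      rw [DirectSum.decompose_sum, DFinsupp.finsetSum_apply, AddSubmonoidClass.coe_finsetSum]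
    rw [DirectSum.decompose_of_mem_same _ ha, Finset.sum_eq_single (𝒢.t h)] at e2
    · have m := 𝒜.mul_mem (𝒢.t h) h (𝒢.s_t h) _
        (SetLike.coe_mem (DirectSum.decompose 𝒜.comp (1 : A) (𝒢.t h))) a ha
      rw [𝒢.tgt_mul] at m
      rw [DirectSum.decompose_of_mem_same _ m] at e2
      exact e2.symm
    · intro g _ hg
      by_cases c : 𝒢.s g = 𝒢.t h
      · have m := 𝒜.mul_mem g h c _
          (SetLike.coe_mem (DirectSum.decompose 𝒜.comp (1 : A) g)) a ha
        exact DirectSum.decompose_of_mem_ne _ m fun q => hg (𝒢.eq_t_of_mul_eq c q)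
      · rw [𝒜.mul_eq_zero g h c _ (SetLike.coe_mem _) a ha]; simp
    · intro hn
      rw [DFinsupp.notMem_support_iff] at hn
      rw [hn]; simp
  · have e1 : a = ∑ i ∈ (DirectSum.decompose 𝒜.comp (1 : A)).support,
        a * (DirectSum.decompose 𝒜.comp (1 : A) i : A) := by
      rw [← Finset.mul_sum, h1, mul_one]
    have e2 : ((DirectSum.decompose 𝒜.comp a) h : A) =
      ∑ i ∈ (DirectSum.decompose 𝒜.comp (1 : A)).support,
        ((DirectSum.decompose 𝒜.comp (a * (DirectSum.decompose 𝒜.comp (1 : A) i : A))) h : A) := by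
      conv_lhs => rw [e1]
      rw [DirectSum.decompose_sum, DFinsupp.finsetSum_apply, AddSubmonoidClass.coe_finsetSum]
    rw [DirectSum.decompose_of_mem_same _ ha, Finset.sum_eq_single (𝒢.s h)] at e2
    · have m := 𝒜.mul_mem h (𝒢.s h) (𝒢.t_s h).symm a ha _
        (SetLike.coe_mem (DirectSum.decompose 𝒜.comp (1 : A) (𝒢.s h)))
      rw [𝒢.mul_src] at m
      rw [DirectSum.decompose_of_mem_same _ m] at e2
      exact e2.symm
    · intro g _ hg
      by_cases c : 𝒢.s h = 𝒢.t g
      · have m := 𝒜.mul_mem h g c a ha _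
          (SetLike.coe_mem (DirectSum.decompose 𝒜.comp (1 : A) g))
        exact DirectSum.decompose_of_mem_ne _ m fun q => hg (𝒢.eq_s_of_mul_eq c q)
      · rw [𝒜.mul_eq_zero h g c a ha _ (SetLike.coe_mem _)]; simp
    · intro hn
      rw [DFinsupp.notMem_support_iff] at hn
      rw [hn]; simp

section Smash

variable {G : Type u} {𝒢 : Gpd G} {X : Type v} {A : Type w} [Ring A]
  (α : GpdSetAction 𝒢 X)

theorem smashMul_zero_left (f : (G × X) →₀ A) : smashMul α 0 f = 0 := by
  simp [smashMul]

theorem smashMul_zero_right (f : (G × X) →₀ A) : smashMul α f 0 = 0 := by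
  simp [smashMul]

theorem smashMul_add_left (f f' g : (G × X) →₀ A) :
    smashMul α (f + f') g = smashMul α f g + smashMul α f' g := by
  unfold smashMul
  apply Finsupp.sum_add_index'
  · intro p; simp
  · intro p a b
    rw [← Finsupp.sum_add]
    refine Finsupp.sum_congr fun q _ => ?_
    split_ifs <;> simp [add_mul]

theorem smashMul_add_right (f g g' : (G × X) →₀ A) :
    smashMul α f (g + g') = smashMul α f g + smashMul α f g' := by
  unfold smashMul
  rw [← Finsupp.sum_add]
  refine Finsupp.sum_congr fun p _ => ?_
  apply Finsupp.sum_add_index'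
  · intro q; simp
  · intro q a b
    split_ifs <;> simp [mul_add]

theorem smashMul_single (p q : G × X) (a b : A) :
    smashMul α (Finsupp.single p a) (Finsupp.single q b) =
      if 𝒢.s p.1 = 𝒢.t q.1 ∧ α.act q.1 q.2 = p.2
      then Finsupp.single (𝒢.mul p.1 q.1, q.2) (a * b) else 0 := by
  unfold smashMul
  rw [Finsupp.sum_single_index, Finsupp.sum_single_index] <;> simp

theorem smashMul_sum_right {ι : Type*} (s : Finset ι) (f : (G × X) →₀ A)
    (g : ι → ((G × X) →₀ A)) :
    smashMul α f (∑ i ∈ s, g i) = ∑ i ∈ s, smashMul α f (g i) :=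
  map_sum (AddMonoidHom.mk' (smashMul α f) (smashMul_add_right α f)) g s

theorem smashMul_sum_left {ι : Type*} (s : Finset ι) (f : (G × X) →₀ A)
    (g : ι → ((G × X) →₀ A)) :
    smashMul α (∑ i ∈ s, g i) f = ∑ i ∈ s, smashMul α (g i) f :=
  map_sum (AddMonoidHom.mk' (fun x => smashMul α x f)
    (fun a b => smashMul_add_left α a b f)) g s

variable {k : Type*} [Field k] [Algebra k A]

theorem smashMul_smul_left (c : k) (f g : (G × X) →₀ A) :
    smashMul α (c • f) g = c • smashMul α f g := by
  induction f using Finsupp.induction_linear with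
  | zero => simp [smashMul_zero_left]
  | add f f' h h' => rw [smul_add, smashMul_add_left, h, h', smashMul_add_left, smul_add]
  | single p a =>
    induction g using Finsupp.induction_linear with
    | zero => simp [smashMul_zero_right]
    | add f f' h h' => rw [smashMul_add_right, h, h', smashMul_add_right, smul_add]
    | single q b =>
      rw [Finsupp.smul_single, smashMul_single, smashMul_single]
      split_ifs <;> simp only [Finsupp.smul_single, smul_mul_assoc, mul_smul_comm, smul_zero]

theorem smashMul_smul_right (c : k) (f g : (G × X) →₀ A) :
    smashMul α f (c • g) = c • smashMul α f g := by
  induction f using Finsupp.induction_linear with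
  | zero => simp [smashMul_zero_left]
  | add f f' h h' => rw [smashMul_add_left, h, h', smashMul_add_left, smul_add]
  | single p a =>
    induction g using Finsupp.induction_linear with
    | zero => simp [smashMul_zero_right]
    | add f f' h h' => rw [smul_add, smashMul_add_right, h, h', smashMul_add_right, smul_add]
    | single q b =>
      rw [Finsupp.smul_single, smashMul_single, smashMul_single]
      split_ifs <;> simp only [Finsupp.smul_single, smul_mul_assoc, mul_smul_comm, smul_zero]

variable (𝒜 : GpdGrading 𝒢 k A)

theorem smash_zero : (0 : (G × X) →₀ A) ∈ smashSet α 𝒜 := by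
  intro p; simp

theorem smash_add {f g : (G × X) →₀ A} (hf : f ∈ smashSet α 𝒜) (hg : g ∈ smashSet α 𝒜) :
    f + g ∈ smashSet α 𝒜 := by
  intro p
  refine ⟨by simpa using (𝒜.comp p.1).add_mem (hf p).1 (hg p).1, fun h => ?_⟩
  by_cases h1 : f p = 0
  · by_cases h2 : g p = 0
    · simp [h1, h2] at h
    · exact (hg p).2 h2
  · exact (hf p).2 h1

theorem smash_smul (c : k) {f : (G × X) →₀ A} (hf : f ∈ smashSet α 𝒜) :
    c • f ∈ smashSet α 𝒜 := by
  intro p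
  refine ⟨by simpa using (𝒜.comp p.1).smul_mem c (hf p).1, fun h => (hf p).2 fun h' => h ?_⟩
  simp [h']

theorem smash_sum {ι : Type*} (s : Finset ι) (g : ι → ((G × X) →₀ A))
    (h : ∀ i ∈ s, g i ∈ smashSet α 𝒜) : ∑ i ∈ s, g i ∈ smashSet α 𝒜 :=
  Finset.sum_induction g (· ∈ smashSet α 𝒜) (fun _ _ => smash_add α 𝒜) (smash_zero α 𝒜) h

theorem smash_single {g : G} {x : X} {a : A} (ha : a ∈ 𝒜.comp g) (hx : x ∈ α.car (𝒢.s g)) :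
    Finsupp.single (g, x) a ∈ smashSet α 𝒜 := by
  intro p
  by_cases h : p = (g, x)
  · subst h; simp [ha, hx]
  · simp [Finsupp.single_eq_of_ne h]

theorem smash_ind {P : ((G × X) →₀ A) → Prop} (h0 : P 0)
    (hadd : ∀ f ∈ smashSet α 𝒜, ∀ g ∈ smashSet α 𝒜, P f → P g → P (f + g))
    (hs : ∀ g x a, a ∈ 𝒜.comp g → x ∈ α.car (𝒢.s g) → P (Finsupp.single (g, x) a)) :
    ∀ f ∈ smashSet α 𝒜, P f := by
  intro f hf
  have : P f ∧ f ∈ smashSet α 𝒜 := by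
    rw [← f.sum_single]
    refine Finset.sum_induction _ (fun f => P f ∧ f ∈ smashSet α 𝒜) ?_ ⟨h0, smash_zero α 𝒜⟩ ?_
    · rintro a b ⟨ha, ha'⟩ ⟨hb, hb'⟩
      exact ⟨hadd _ ha' _ hb' ha hb, smash_add α 𝒜 ha' hb'⟩
    · intro p hp
      have := (hf p).2 (Finsupp.mem_support_iff.1 hp)
      exact ⟨hs _ _ _ (hf p).1 this, smash_single α 𝒜 (hf p).1 this⟩
  exact this.1

theorem smash_mul {f g : (G × X) →₀ A} (hf : f ∈ smashSet α 𝒜) (hg : g ∈ smashSet α 𝒜) :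
    smashMul α f g ∈ smashSet α 𝒜 := by
  revert f
  apply smash_ind
  · rw [smashMul_zero_left]; exact smash_zero α 𝒜
  · intro f _ g _ h h'
    rw [smashMul_add_left]; exact smash_add α 𝒜 h h'
  intro p x a ha hx
  revert g
  apply smash_ind
  · rw [smashMul_zero_right]; exact smash_zero α 𝒜
  · intro f _ g _ h h'
    rw [smashMul_add_right]; exact smash_add α 𝒜 h h'
  intro q y b hb hy
  rw [smashMul_single]
  split_ifs with h
  · exact smash_single α 𝒜 (𝒜.mul_mem _ _ h.1 _ ha _ hb) (by rwa [𝒢.s_mul _ _ h.1])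
  · exact smash_zero α 𝒜

theorem smash_assoc {f g h : (G × X) →₀ A} (hf : f ∈ smashSet α 𝒜) (hg : g ∈ smashSet α 𝒜)
    (hh : h ∈ smashSet α 𝒜) :
    smashMul α (smashMul α f g) h = smashMul α f (smashMul α g h) := by
  revert f
  apply smash_ind
  · simp only [smashMul_zero_left]
  · intro f _ g _ h h'
    simp only [smashMul_add_left, h, h']
  intro p x a ha hx
  revert g
  apply smash_ind
  · simp only [smashMul_zero_left, smashMul_zero_right]
  · intro f _ g _ h h'
    simp only [smashMul_add_left, smashMul_add_right, h, h']
  intro q y b hb hy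
  revert h
  apply smash_ind
  · simp only [smashMul_zero_right]
  · intro f _ g _ h h'
    simp only [smashMul_add_right, h, h']
  intro r z c hc hz
  rw [smashMul_single, smashMul_single]
  dsimp only
  by_cases h1 : 𝒢.s q = 𝒢.t r ∧ α.act r z = y
  · rw [if_pos h1, smashMul_single]
    dsimp only
    rw [𝒢.t_mul _ _ h1.1, ← α.act_comp h1.1 hz, h1.2]
    by_cases h2 : 𝒢.s p = 𝒢.t q ∧ α.act q y = x
    · rw [if_pos h2, if_pos h2, smashMul_single, if_pos, 𝒢.mul_assoc _ _ _ h2.1 h1.1, mul_assoc]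
      dsimp only
      rwa [𝒢.s_mul _ _ h2.1]
    · rw [if_neg h2, if_neg h2, smashMul_zero_left]
  · rw [if_neg h1, smashMul_zero_right]
    split_ifs with h2
    · rw [smashMul_single, if_neg]
      dsimp only
      rwa [𝒢.s_mul _ _ h2.1]
    · rw [smashMul_zero_left]

end Smash

section Gamma

variable {G : Type u} {K : Type*} {𝒢 : Gpd G} {𝒦 : Gpd K} {X : Type v} {A : Type w} [Ring A]
  (α : GpdSetAction 𝒢 X) (β : GpdSetAction 𝒦 X)

theorem gamma_zero (κ : K) : gammaAct β κ (0 : (G × X) →₀ A) = 0 := by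
  simp [gammaAct]

theorem gamma_add (κ : K) (f g : (G × X) →₀ A) :
    gammaAct β κ (f + g) = gammaAct β κ f + gammaAct β κ g := by
  unfold gammaAct
  apply Finsupp.sum_add_index'
  · intro p; simp
  · intro p a b
    split_ifs <;> simp

theorem gamma_single (κ : K) (p : G × X) (a : A) :
    gammaAct β κ (Finsupp.single p a) =
      if p.2 ∈ β.car (𝒦.s κ) then Finsupp.single (p.1, β.act κ p.2) a else 0 := by
  unfold gammaAct
  rw [Finsupp.sum_single_index, β.car_inv]
  simp

variable {k : Type*} [Field k] [Algebra k A]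

theorem gamma_smul (κ : K) (c : k) (f : (G × X) →₀ A) :
    gammaAct β κ (c • f) = c • gammaAct β κ f := by
  induction f using Finsupp.induction_linear with
  | zero => simp [gamma_zero]
  | add f f' h h' => rw [smul_add, gamma_add, h, h', gamma_add, smul_add]
  | single p a =>
    rw [Finsupp.smul_single, gamma_single, gamma_single]
    split_ifs <;> simp

variable {α β} (𝒜 : GpdGrading 𝒢 k A)

theorem GKCompat.beta_mem (hc : GKCompat α β) {g : G} {κ : K} {x : X} (hx : x ∈ α.car g)
    (hy : x ∈ β.car (𝒦.s κ)) : β.act κ x ∈ α.car g :=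
  (hc.beta_inv g κ ⟨x, ⟨hx, by rwa [β.car_inv]⟩, rfl⟩).1

theorem GKCompat.alpha_mem (hc : GKCompat α β) {g : G} {κ : K} {x : X} (hx : x ∈ α.car (𝒢.s g))
    (hy : x ∈ β.car κ) : α.act g x ∈ β.car κ :=
  (hc.alpha_inv g κ ⟨x, ⟨by rwa [α.car_inv], hy⟩, rfl⟩).2

theorem GKCompat.comm' (hc : GKCompat α β) {g : G} {κ : K} {x : X} (hx : x ∈ α.car (𝒢.s g))
    (hy : x ∈ β.car (𝒦.s κ)) : α.act g (β.act κ x) = β.act κ (α.act g x) :=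
  hc.comm g κ x ⟨by rwa [α.car_inv], by rwa [β.car_inv]⟩

theorem gamma_mem (hc : GKCompat α β) (κ : K) :
    ∀ f ∈ smashSet α 𝒜, gammaAct β κ f ∈ smashSet α 𝒜 := by
  apply smash_ind
  · rw [gamma_zero]; exact smash_zero α 𝒜
  · intro f _ g _ h h'
    rw [gamma_add]; exact smash_add α 𝒜 h h'
  intro g x a ha hx
  rw [gamma_single]
  split_ifs with h
  · exact smash_single α 𝒜 ha (hc.beta_mem hx h)
  · exact smash_zero α 𝒜

theorem gamma_mul (hc : GKCompat α β) (κ : K) {f g : (G × X) →₀ A}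
    (hf : f ∈ smashSet α 𝒜) (hg : g ∈ smashSet α 𝒜) :
    gammaAct β κ (smashMul α f g) = smashMul α (gammaAct β κ f) (gammaAct β κ g) := by
  revert f
  apply smash_ind
  · simp only [smashMul_zero_left, gamma_zero]
  · intro f _ g _ h h'
    simp only [smashMul_add_left, gamma_add, h, h']
  intro p x a ha hx
  revert g
  apply smash_ind
  · simp only [smashMul_zero_right, gamma_zero]
  · intro f _ g _ h h'
    simp only [smashMul_add_right, gamma_add, h, h']
  intro q y b hb hy
  rw [smashMul_single, gamma_single, gamma_single]
  dsimp only
  by_cases hyK : y ∈ β.car (𝒦.s κ)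
  · rw [if_pos hyK]
    by_cases hxK : x ∈ β.car (𝒦.s κ)
    · rw [if_pos hxK, smashMul_single]
      dsimp only
      rw [hc.comm' hy hyK]
      by_cases h : 𝒢.s p = 𝒢.t q ∧ α.act q y = x
      · rw [if_pos h, if_pos, gamma_single, if_pos hyK]
        rw [h.2]; exact ⟨h.1, rfl⟩
      · rw [if_neg h, if_neg, gamma_zero]
        rintro ⟨h1, h2⟩
        exact h ⟨h1, β.act_inj (hc.alpha_mem hy hyK) hxK h2⟩
    · rw [if_neg hxK, smashMul_zero_left, if_neg, gamma_zero]
      rintro ⟨h1, rfl⟩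
      exact hxK (hc.alpha_mem hy hyK)
  · rw [if_neg hyK, smashMul_zero_right]
    split_ifs
    · rw [gamma_single, if_neg hyK]
    · rw [gamma_zero]

theorem gamma_comp {κ l : K} (h : 𝒦.s κ = 𝒦.t l) (f : (G × X) →₀ A) :
    gammaAct β κ (gammaAct β l f) = gammaAct β (𝒦.mul κ l) f := by
  induction f using Finsupp.induction_linear with
  | zero => simp [gamma_zero]
  | add f f' h h' => simp only [gamma_add, h, h']
  | single p a =>
    rw [gamma_single, gamma_single, 𝒦.s_mul _ _ h]
    split_ifs with h1
    · rw [gamma_single, if_pos]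
      · dsimp only
        rw [β.act_comp h h1]
      · dsimp only; rw [h]; exact β.act_mem h1
    · rw [gamma_zero]

theorem gamma_vanish (hsβ : β.Split) {κ l : K} (h : 𝒦.s κ ≠ 𝒦.t l) (f : (G × X) →₀ A) :
    gammaAct β κ (gammaAct β l f) = 0 := by
  induction f using Finsupp.induction_linear with
  | zero => simp [gamma_zero]
  | add f f' h h' => simp only [gamma_add, h, h', add_zero]
  | single p a =>
    rw [gamma_single]
    split_ifs with h1
    · rw [gamma_single, if_neg]
      intro h2
      exact h (hsβ.eq (𝒦.obj_s _) (𝒦.obj_t _) h2 (β.act_mem h1))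
    · rw [gamma_zero]

end Gamma


section Phi

variable {G : Type u} {K : Type*} {𝒢 : Gpd G} {𝒦 : Gpd K} {X : Type v} {A : Type w} [Ring A]
  (α : GpdSetAction 𝒢 X) (β : GpdSetAction 𝒦 X)

theorem orbit_self (hsβ : β.Split) (x : X) : x ∈ orbit β x := by
  obtain ⟨e, ⟨he, hx⟩, -⟩ := hsβ x
  refine ⟨e, ?_, β.act_id e he x hx⟩
  have h' : 𝒦.s e = e := he
  rw [β.car_inv, h']
  exact hx

theorem orbit_act (hsβ : β.Split) {κ : K} {x : X} (hx : x ∈ β.car (𝒦.s κ)) :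
    orbit β (β.act κ x) = orbit β x := by
  have hm := β.act_mem hx
  ext y
  constructor
  · rintro ⟨l, hl, rfl⟩
    rw [β.car_inv] at hl
    have c : 𝒦.s l = 𝒦.t κ := hsβ.eq (𝒦.obj_s l) (𝒦.obj_t κ) hl hm
    refine ⟨𝒦.mul l κ, ?_, ?_⟩
    · rwa [β.car_inv, 𝒦.s_mul _ _ c]
    · rw [β.act_comp c hx]
  · rintro ⟨l, hl, rfl⟩
    rw [β.car_inv] at hl
    have c : 𝒦.s l = 𝒦.s κ := hsβ.eq (𝒦.obj_s l) (𝒦.obj_s κ) hl hx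
    have c' : 𝒦.s l = 𝒦.t (𝒦.inv κ) := by rw [𝒦.t_inv, c]
    refine ⟨𝒦.mul l (𝒦.inv κ), ?_, ?_⟩
    · rwa [β.car_inv, 𝒦.s_mul _ _ c', 𝒦.s_inv]
    · rw [← β.act_comp c' (by rwa [𝒦.s_inv]), β.act_inv_act hx]

variable [Finite X]

theorem phi_zero : phiStar α β (0 : (G × OrbT β) →₀ A) = 0 := by
  simp [phiStar]

theorem phi_add (f g : (G × OrbT β) →₀ A) :
    phiStar α β (f + g) = phiStar α β f + phiStar α β g := by
  unfold phiStar
  apply Finsupp.sum_add_index'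
  · intro p; simp
  · intro p a b
    rw [← finsum_mem_add_distrib (Set.toFinite _)]
    simp

theorem phi_single [Fintype X] (h : G) (o : OrbT β) (b : A) :
    phiStar α β (Finsupp.single (h, o) b) =
      ∑ y ∈ Finset.univ.filter (fun y => y ∈ α.car (𝒢.s h) ∧ orbit β y = (o : Set X)),
        Finsupp.single (h, y) b := by
  unfold phiStar
  rw [Finsupp.sum_single_index]
  · rw [finsum_mem_eq_finite_toFinset_sum _ (Set.toFinite _)]
    refine Finset.sum_congr ?_ fun _ _ => rfl
    ext; simp
  · simp

variable {k : Type*} [Field k] [Algebra k A] (𝒜 : GpdGrading 𝒢 k A)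

theorem phi_mem (lam : GpdSetAction 𝒢 (OrbT β)) :
    ∀ w ∈ smashSet lam 𝒜, phiStar α β w ∈ smashSet α 𝒜 := by
  have := Fintype.ofFinite X
  apply smash_ind
  · rw [phi_zero]; exact smash_zero α 𝒜
  · intro f _ g _ h h'
    rw [phi_add]; exact smash_add α 𝒜 h h'
  intro g o a ha ho
  rw [phi_single]
  refine smash_sum α 𝒜 _ _ fun y hy => ?_
  exact smash_single α 𝒜 ha (Finset.mem_filter.1 hy).2.1

theorem mul_phi_single {g : G} {x : X} (hx : x ∈ α.car (𝒢.s g)) (a : A) (h : G) (o : OrbT β)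
    (b : A) :
    smashMul α (Finsupp.single (g, x) a) (phiStar α β (Finsupp.single (h, o) b)) =
      if 𝒢.s g = 𝒢.t h ∧ orbit β (α.act (𝒢.inv h) x) = (o : Set X)
      then Finsupp.single (𝒢.mul g h, α.act (𝒢.inv h) x) (a * b) else 0 := by
  have := Fintype.ofFinite X
  rw [phi_single, smashMul_sum_right]
  by_cases c : 𝒢.s g = 𝒢.t h
  · rw [c] at hx
    have key : ∀ y ∈ α.car (𝒢.s h), α.act h y = x → y = α.act (𝒢.inv h) x := by
      rintro y hy rfl
      rw [α.act_inv_act hy]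
    by_cases c2 : orbit β (α.act (𝒢.inv h) x) = (o : Set X)
    · rw [if_pos ⟨c, c2⟩, Finset.sum_eq_single (α.act (𝒢.inv h) x)]
      · rw [smashMul_single, if_pos ⟨c, α.act_act_inv hx⟩]
      · intro y hy hne
        rw [smashMul_single, if_neg]
        rintro ⟨-, h2⟩
        exact hne (key y (Finset.mem_filter.1 hy).2.1 h2)
      · intro hn
        exact absurd (Finset.mem_filter.2 ⟨Finset.mem_univ _, α.act_mem_inv hx, c2⟩) hn
    · rw [if_neg fun q => c2 q.2]
      refine Finset.sum_eq_zero fun y hy => ?_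
      rw [smashMul_single, if_neg]
      rintro ⟨-, h2⟩
      have hy' := (Finset.mem_filter.1 hy).2
      apply c2
      rw [← key y hy'.1 h2]
      exact hy'.2
  · rw [if_neg fun q => c q.1]
    refine Finset.sum_eq_zero fun y hy => ?_
    rw [smashMul_single, if_neg fun q => c q.1]

variable {α β}

theorem gamma_phi (hsβ : β.Split) (hc : GKCompat α β) (lam : GpdSetAction 𝒢 (OrbT β)) (κ : K)
    {f : (G × X) →₀ A} (hf : f ∈ smashSet α 𝒜) {w : (G × OrbT β) →₀ A}
    (hw : w ∈ smashSet lam 𝒜) :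
    gammaAct β κ (smashMul α f (phiStar α β w)) =
      smashMul α (gammaAct β κ f) (phiStar α β w) := by
  revert f
  apply smash_ind
  · simp only [smashMul_zero_left, gamma_zero]
  · intro f _ g _ h h'
    simp only [smashMul_add_left, gamma_add, h, h']
  intro g x a ha hx
  revert w
  apply smash_ind
  · simp only [phi_zero, smashMul_zero_right, gamma_zero]
  · intro f _ g _ h h'
    simp only [phi_add, smashMul_add_right, gamma_add, h, h']
  intro h o b hb ho
  rw [mul_phi_single α β hx, gamma_single]
  dsimp only
  by_cases c : 𝒢.s g = 𝒢.t h
  · have hx' : x ∈ α.car (𝒢.s (𝒢.inv h)) := by rwa [𝒢.s_inv, ← c]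
    by_cases hxK : x ∈ β.car (𝒦.s κ)
    · rw [if_pos hxK, mul_phi_single α β (hc.beta_mem hx hxK), hc.comm' hx' hxK,
        orbit_act β hsβ (hc.alpha_mem hx' hxK)]
      split_ifs
      · rw [gamma_single, if_pos (hc.alpha_mem hx' hxK)]
      · rw [gamma_zero]
    · rw [if_neg hxK, smashMul_zero_left]
      split_ifs
      · rw [gamma_single, if_neg]
        intro q
        apply hxK
        have hm : x ∈ α.car (𝒢.t h) := by rwa [← c]
        rw [← α.act_act_inv hm]
        exact hc.alpha_mem (α.act_mem_inv hm) q
      · rw [gamma_zero]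
  · rw [if_neg fun q => c q.1, gamma_zero]
    split_ifs with hxK
    · rw [mul_phi_single α β (hc.beta_mem hx hxK), if_neg fun q => c q.1]
    · rw [smashMul_zero_left]

end Phi

section Psi

variable {G : Type u} {K : Type*} {𝒢 : Gpd G} {𝒦 : Gpd K} {X : Type v} {A : Type w} [Ring A]
  (α : GpdSetAction 𝒢 X) (β : GpdSetAction 𝒦 X)

/-- The duality map. -/
def psi (F : K →₀ ((G × X) →₀ A)) (f : (G × X) →₀ A) : (G × X) →₀ A :=
  F.sum fun κ b => smashMul α b (gammaAct β κ f)

theorem psi_add (F F' : K →₀ ((G × X) →₀ A)) (f : (G × X) →₀ A) :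
    psi α β (F + F') f = psi α β F f + psi α β F' f := by
  unfold psi
  apply Finsupp.sum_add_index'
  · intro κ; rw [smashMul_zero_left]
  · intro κ b b'; rw [smashMul_add_left]

theorem psi_zero (f : (G × X) →₀ A) : psi α β (0 : K →₀ ((G × X) →₀ A)) f = 0 := by
  simp [psi]

theorem psi_single (κ : K) (b f : (G × X) →₀ A) :
    psi α β (Finsupp.single κ b) f = smashMul α b (gammaAct β κ f) := by
  unfold psi
  rw [Finsupp.sum_single_index]
  rw [smashMul_zero_left]

theorem psi_sum {ι : Type*} (s : Finset ι) (g : ι → (K →₀ ((G × X) →₀ A))) (f : (G × X) →₀ A) :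
    psi α β (∑ i ∈ s, g i) f = ∑ i ∈ s, psi α β (g i) f :=
  map_sum (AddMonoidHom.mk' (fun x => psi α β x f) (fun a b => psi_add α β a b f)) g s

theorem psi_add_right (F : K →₀ ((G × X) →₀ A)) (f f' : (G × X) →₀ A) :
    psi α β F (f + f') = psi α β F f + psi α β F f' := by
  unfold psi
  rw [← Finsupp.sum_add]
  refine Finsupp.sum_congr fun κ _ => ?_
  rw [gamma_add, smashMul_add_right]

theorem gamma_sum {ι : Type*} (s : Finset ι) (κ : K) (g : ι → ((G × X) →₀ A)) :
    gammaAct β κ (∑ i ∈ s, g i) = ∑ i ∈ s, gammaAct β κ (g i) := by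
  induction s using Finset.induction_on with
  | empty => simp only [Finset.sum_empty, gamma_zero]
  | insert i s hi ih => rw [Finset.sum_insert hi, Finset.sum_insert hi, gamma_add, ih]

variable {k : Type*} [Field k] [Algebra k A] (𝒜 : GpdGrading 𝒢 k A)

theorem psi_smul (c : k) (F : K →₀ ((G × X) →₀ A)) (f : (G × X) →₀ A) :
    psi α β (c • F) f = c • psi α β F f := by
  induction F using Finsupp.induction_linear with
  | zero => simp [psi_zero]
  | add f f' h h' => rw [smul_add, psi_add, h, h', psi_add, smul_add]
  | single κ b => rw [Finsupp.smul_single, psi_single, psi_single, smashMul_smul_left]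

variable {α β}

theorem psi_mul (hsβ : β.Split) (hc : GKCompat α β) {F₁ F₂ : K →₀ ((G × X) →₀ A)}
    (h₁ : F₁ ∈ skewSet α β 𝒜) (h₂ : F₂ ∈ skewSet α β 𝒜) {f : (G × X) →₀ A}
    (hf : f ∈ smashSet α 𝒜) :
    psi α β (skewMul α β F₁ F₂) f = psi α β F₁ (psi α β F₂ f) := by
  unfold skewMul
  rw [Finsupp.sum, psi_sum]
  conv_rhs => rw [psi, Finsupp.sum]
  refine Finset.sum_congr rfl fun κ _ => ?_
  rw [Finsupp.sum, psi_sum]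
  conv_rhs => rw [psi, Finsupp.sum, gamma_sum, smashMul_sum_right]
  refine Finset.sum_congr rfl fun l _ => ?_
  have m1 := (h₁ κ).1
  have m2 := (h₂ l).1
  have m3 := gamma_mem 𝒜 hc l f hf
  rw [gamma_mul 𝒜 hc κ m2 m3]
  split_ifs with h
  · rw [psi_single, gamma_comp h, smash_assoc α 𝒜 m1 (gamma_mem 𝒜 hc κ _ m2)
      (gamma_mem 𝒜 hc _ f hf)]
  · rw [gamma_vanish hsβ h, smashMul_zero_right, smashMul_zero_right, psi_zero]

theorem psi_isRModEnd [Finite X] (hsβ : β.Split) (hc : GKCompat α β) (lam : GpdSetAction 𝒢 (OrbT β))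
    {F : K →₀ ((G × X) →₀ A)} (h : F ∈ skewSet α β 𝒜) :
    IsRModEnd α β 𝒜 lam (psi α β F) := by
  refine ⟨?_, ?_, ?_, ?_⟩
  · intro f hf
    exact smash_sum α 𝒜 _ _ fun κ _ => smash_mul α 𝒜 (h κ).1 (gamma_mem 𝒜 hc κ f hf)
  · intro f _ f' _
    exact psi_add_right α β F f f'
  · intro c f _
    unfold psi
    rw [Finsupp.smul_sum]
    refine Finsupp.sum_congr fun κ _ => ?_
    rw [gamma_smul, smashMul_smul_right]
  · intro f hf w hw
    unfold psi
    rw [Finsupp.sum, Finsupp.sum, smashMul_sum_left]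
    refine Finset.sum_congr rfl fun κ _ => ?_
    rw [gamma_phi 𝒜 hsβ hc lam κ hf hw, smash_assoc α 𝒜 (h κ).1 (gamma_mem 𝒜 hc κ f hf)
      (phi_mem α β 𝒜 lam w hw)]

theorem mul_unit (hsα : α.Split) {one : G → A}
    (h1 : ∀ h, ∀ a ∈ 𝒜.comp h, one (𝒢.t h) * a = a ∧ a * one (𝒢.s h) = a)
    {e : G} (he : 𝒢.obj e) {x : X} (hx : x ∈ α.car e) :
    ∀ b ∈ smashSet α 𝒜, smashMul α b (Finsupp.single (e, x) (one e)) =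
      b.filter (fun p => p.2 = x) := by
  apply smash_ind
  · rw [smashMul_zero_left, Finsupp.filter_zero]
  · intro f _ g _ h h'
    rw [smashMul_add_left, Finsupp.filter_add, h, h']
  intro g y a ha hy
  rw [smashMul_single]
  dsimp only
  rw [α.act_id e he x hx, 𝒢.t_of_obj he]
  by_cases c : y = x
  · subst c
    have : 𝒢.s g = e := hsα.eq (𝒢.obj_s g) he hy hx
    subst this
    rw [if_pos ⟨rfl, rfl⟩, 𝒢.mul_src, (h1 g a ha).2, Finsupp.filter_single_of_pos]
    rfl
  · rw [if_neg fun q => c q.2.symm, Finsupp.filter_single_of_neg]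
    exact c

variable (β)

theorem psi_unit (hsα : α.Split) (hc : GKCompat α β) {one : G → A}
    (h1 : ∀ h, ∀ a ∈ 𝒜.comp h, one (𝒢.t h) * a = a ∧ a * one (𝒢.s h) = a)
    {e : G} (he : 𝒢.obj e) {z : X} (hz : z ∈ α.car e)
    {F : K →₀ ((G × X) →₀ A)} (hF : F ∈ skewSet α β 𝒜) :
    psi α β F (Finsupp.single (e, z) (one e)) =
      F.sum fun κ b => if z ∈ β.car (𝒦.s κ) then b.filter (fun p => p.2 = β.act κ z) else 0 := by
  unfold psi
  refine Finsupp.sum_congr fun κ _ => ?_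
  rw [gamma_single]
  dsimp only
  split_ifs with h
  · exact mul_unit 𝒜 hsα h1 he (hc.beta_mem hz h) _ (hF κ).1
  · rw [smashMul_zero_right]

theorem psi_unit_apply (hsα : α.Split) (hsβ : β.Split) (hc : GKCompat α β)
    (hff : β.FullyFaithful) {one : G → A}
    (h1 : ∀ h, ∀ a ∈ 𝒜.comp h, one (𝒢.t h) * a = a ∧ a * one (𝒢.s h) = a)
    {e : G} (he : 𝒢.obj e) {z : X} (hz : z ∈ α.car e)
    {F : K →₀ ((G × X) →₀ A)} (hF : F ∈ skewSet α β 𝒜) (g : G) {κ : K}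
    (hκ : z ∈ β.car (𝒦.s κ)) :
    psi α β F (Finsupp.single (e, z) (one e)) (g, β.act κ z) = F κ (g, β.act κ z) := by
  rw [psi_unit β 𝒜 hsα hc h1 he hz hF, Finsupp.sum, Finsupp.finsetSum_apply,
    Finset.sum_eq_single κ]
  · rw [if_pos hκ, Finsupp.filter_apply_pos]
    rfl
  · intro l _ hl
    split_ifs with h
    · rw [Finsupp.filter_apply_neg]
      intro q
      exact hl (hff.eq hsβ h hκ q.symm)
    · rfl
  · intro hn
    rw [Finsupp.notMem_support_iff] at hn
    rw [hn, if_pos hκ, Finsupp.filter_zero]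
    rfl

theorem psi_unit_apply_zero (hsα : α.Split) (hc : GKCompat α β) {one : G → A}
    (h1 : ∀ h, ∀ a ∈ 𝒜.comp h, one (𝒢.t h) * a = a ∧ a * one (𝒢.s h) = a)
    {e : G} (he : 𝒢.obj e) {z : X} (hz : z ∈ α.car e)
    {F : K →₀ ((G × X) →₀ A)} (hF : F ∈ skewSet α β 𝒜) (g : G) {x : X}
    (hx : ∀ κ, z ∈ β.car (𝒦.s κ) → x ≠ β.act κ z) :
    psi α β F (Finsupp.single (e, z) (one e)) (g, x) = 0 := by
  rw [psi_unit β 𝒜 hsα hc h1 he hz hF, Finsupp.sum, Finsupp.finsetSum_apply]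
  refine Finset.sum_eq_zero fun l _ => ?_
  split_ifs with h
  · rw [Finsupp.filter_apply_neg]
    exact hx l h
  · rfl

variable {β}

theorem psi_inj (hsα : α.Split) (hsβ : β.Split) (hc : GKCompat α β)
    (hff : β.FullyFaithful) {F₁ F₂ : K →₀ ((G × X) →₀ A)}
    (h₁ : F₁ ∈ skewSet α β 𝒜) (h₂ : F₂ ∈ skewSet α β 𝒜)
    (h : ∀ f ∈ smashSet α 𝒜, psi α β F₁ f = psi α β F₂ f) : F₁ = F₂ := by
  obtain ⟨one, hone, h1⟩ := 𝒜.exists_one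
  ext κ ⟨g, x⟩
  by_cases hx : x ∈ β.car κ
  · rw [β.car_t] at hx
    have hz := β.act_mem_inv hx
    have hxz := β.act_act_inv hx
    generalize β.act (𝒦.inv κ) x = z at hz hxz
    subst hxz
    have he := GpdSetAction.ob_obj hsα z
    have hm := GpdSetAction.mem_ob hsα z
    rw [← psi_unit_apply β 𝒜 hsα hsβ hc hff h1 he hm h₁ g hz,
      ← psi_unit_apply β 𝒜 hsα hsβ hc hff h1 he hm h₂ g hz, h]
    refine smash_single α 𝒜 (hone _) ?_
    have he' : 𝒢.s (GpdSetAction.ob hsα z) = GpdSetAction.ob hsα z := he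
    rwa [he']
  · have e1 : F₁ κ (g, x) = 0 := by
      by_contra q
      exact hx ((h₁ κ).2 _ q)
    have e2 : F₂ κ (g, x) = 0 := by
      by_contra q
      exact hx ((h₂ κ).2 _ q)
    rw [e1, e2]

theorem mul_phi_vanish [Finite X] (h : G) (o : OrbT β) (b : A)
    (g : G) (x : X) (hx : orbit β x ≠ (o : Set X)) :
    ∀ f ∈ smashSet α 𝒜,
      smashMul α f (phiStar α β (Finsupp.single (h, o) b)) (g, x) = 0 := by
  apply smash_ind
  · rw [smashMul_zero_left]; rfl
  · intro f _ f' _ h h'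
    rw [smashMul_add_left, Finsupp.add_apply, h, h', add_zero]
  intro l y a ha hy
  rw [mul_phi_single α β hy]
  split_ifs with c
  · rw [Finsupp.single_eq_of_ne]
    intro q
    apply hx
    rw [(Prod.mk.inj q).2]
    exact c.2
  · rfl

theorem psi_surj [Finite X] (hsα : α.Split) (hsβ : β.Split) (hc : GKCompat α β)
    (hff : β.FullyFaithful) (lam : GpdSetAction 𝒢 (OrbT β))
    (hlam₁ : ∀ g, lam.car g = {o : OrbT β | ∃ x ∈ α.car g, orbit β x = (o : Set X)})
    (F : ((G × X) →₀ A) → ((G × X) →₀ A)) (hF : IsRModEnd α β 𝒜 lam F) :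
    ∃ Fs ∈ skewSet α β 𝒜, ∀ f ∈ smashSet α 𝒜, psi α β Fs f = F f := by
  have := Fintype.ofFinite X
  obtain ⟨one, hone, h1⟩ := 𝒜.exists_one
  obtain ⟨F1, F2, F3, F4⟩ := hF
  have F0 : F 0 = 0 := by
    have := F3 0 0 (smash_zero α 𝒜)
    simpa using this
  let U : X → ((G × X) →₀ A) := fun z =>
    Finsupp.single (GpdSetAction.ob hsα z, z) (one (GpdSetAction.ob hsα z))
  have hU : ∀ z, U z ∈ smashSet α 𝒜 := by
    intro z
    refine smash_single α 𝒜 (hone _) ?_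
    have he' : 𝒢.s (GpdSetAction.ob hsα z) = GpdSetAction.ob hsα z := GpdSetAction.ob_obj hsα z
    rw [he']
    exact GpdSetAction.mem_ob hsα z
  -- every homogeneous element is a multiple of a unit
  have hfac : ∀ h y a, a ∈ 𝒜.comp h → y ∈ α.car (𝒢.s h) →
      Finsupp.single (h, y) a =
        smashMul α (U (α.act h y)) (phiStar α β (Finsupp.single (h, orbMap β y) a)) := by
    intro h y a ha hy
    have hz := α.act_mem hy
    have hob : GpdSetAction.ob hsα (α.act h y) = 𝒢.t h :=
      GpdSetAction.ob_eq hsα (𝒢.obj_t h) hz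
    simp only [U]
    rw [hob, mul_phi_single α β (by rwa [𝒢.s_t]), α.act_inv_act hy, 𝒢.s_t,
      if_pos ⟨rfl, rfl⟩, 𝒢.tgt_mul, (h1 h a ha).1]
  have hlm : ∀ h y a, a ∈ 𝒜.comp h → y ∈ α.car (𝒢.s h) →
      Finsupp.single (h, orbMap β y) a ∈ smashSet lam 𝒜 := by
    intro h y a ha hy
    refine smash_single lam 𝒜 ha ?_
    rw [hlam₁]
    exact ⟨y, hy, rfl⟩
  have hsupp : ∀ z g x, orbit β x ≠ orbit β z → F (U z) (g, x) = 0 := by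
    intro z g x hx
    have he := GpdSetAction.ob_obj hsα z
    have hm := GpdSetAction.mem_ob hsα z
    have he' : 𝒢.s (GpdSetAction.ob hsα z) = GpdSetAction.ob hsα z := he
    have hm' : z ∈ α.car (𝒢.s (GpdSetAction.ob hsα z)) := by rwa [he']
    have e := hfac _ z _ (hone (GpdSetAction.ob hsα z)) hm'
    rw [α.act_id _ he z hm] at e
    have e2 : F (U z) = _ := (congrArg F e).trans (F4 _ (hU z) _ (hlm _ z _ (hone _) hm'))
    rw [e2]
    exact mul_phi_vanish 𝒜 _ _ _ _ _ hx _ (F1 _ (hU z))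
  let D : K → ((G × X) →₀ A) := fun κ => ∑ x : X,
    if x ∈ β.car κ then (F (U (β.act (𝒦.inv κ) x))).filter (fun p => p.2 = x) else 0
  have hD : ∀ κ g x, D κ (g, x) =
      if x ∈ β.car κ then F (U (β.act (𝒦.inv κ) x)) (g, x) else 0 := by
    intro κ g x
    simp only [D]
    rw [Finsupp.finsetSum_apply, Finset.sum_eq_single x]
    · split_ifs
      · rw [Finsupp.filter_apply_pos]; rfl
      · rfl
    · intro y _ hy
      split_ifs
      · rw [Finsupp.filter_apply_neg]; exact hy.symm
      · rfl
    · intro hn; exact absurd (Finset.mem_univ _) hn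
  have hfin : (Function.support D).Finite := by
    refine (GpdSetAction.finite_nonempty hff hsβ).subset ?_
    intro κ hκ
    by_contra hn
    apply hκ
    ext ⟨g, x⟩
    rw [hD, if_neg]
    · rfl
    · exact fun hx => hn ⟨x, hx⟩
  let Fs : K →₀ ((G × X) →₀ A) := Finsupp.ofSupportFinite D hfin
  have hFs : ∀ κ, Fs κ = D κ := fun κ => rfl
  have hsk : Fs ∈ skewSet α β 𝒜 := by
    intro κ
    rw [hFs]
    refine ⟨?_, ?_⟩
    · rintro ⟨g, x⟩
      rw [hD]
      split_ifs
      · exact F1 _ (hU _) (g, x)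
      · exact smash_zero α 𝒜 (g, x)
    · rintro ⟨g, x⟩ hne
      rw [hD] at hne
      by_contra hn
      exact hne (if_neg hn)
  have hunit : ∀ z, psi α β Fs (U z) = F (U z) := by
    intro z
    have he := GpdSetAction.ob_obj hsα z
    have hm := GpdSetAction.mem_ob hsα z
    ext ⟨g, x⟩
    by_cases hx : ∃ κ, z ∈ β.car (𝒦.s κ) ∧ x = β.act κ z
    · obtain ⟨κ, hκ, rfl⟩ := hx
      have := psi_unit_apply β 𝒜 hsα hsβ hc hff h1 he hm hsk g hκ
      refine this.trans ?_
      rw [hFs, hD, if_pos, β.act_inv_act hκ]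
      rw [β.car_t]
      exact β.act_mem hκ
    · push Not at hx
      refine (psi_unit_apply_zero β 𝒜 hsα hc h1 he hm hsk g hx).trans (hsupp z g x ?_).symm
      intro q
      have hxx := orbit_self β hsβ x
      rw [q] at hxx
      obtain ⟨κ, hκ, hκ'⟩ := hxx
      rw [β.car_inv] at hκ
      exact hx κ hκ hκ'.symm
  obtain ⟨-, -, -, P4⟩ := psi_isRModEnd 𝒜 hsβ hc lam hsk
  refine ⟨Fs, hsk, ?_⟩
  apply smash_ind
  · rw [F0]
    have := psi_add_right α β Fs 0 0
    simpa using this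
  · intro f hf f' hf' h h'
    rw [psi_add_right, F2 f hf f' hf', h, h']
  intro h y a ha hy
  rw [hfac h y a ha hy, P4 _ (hU _) _ (hlm h y a ha hy), F4 _ (hU _) _ (hlm h y a ha hy), hunit]

end Psi

end Helpers

/-- **Duality theorem.**  Let `𝒢, 𝒦` be groupoids with `𝒢₀`
and `𝒦₀` finite, `A` a unital `𝒢`-graded algebra and `X` a finite split
`(𝒢_α, 𝒦_β)`-set.  If the action of `𝒦` on `X` is fully faithful, then
`(A #_α^𝒢 X) *_γ 𝒦 ≅ End((A #_α^𝒢 X)_{A #_λ^𝒢 O^𝒦})` as algebras. -/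
theorem duality_theorem
    {G : Type u} {K : Type*} (𝒢 : Gpd G) (𝒦 : Gpd K) {X : Type v}
    (k : Type*) (A : Type w) [Field k] [Ring A] [Algebra k A] [Finite X]
    (hG₀ : 𝒢.Objs.Finite) (hK₀ : 𝒦.Objs.Finite) (𝒜 : GpdGrading 𝒢 k A)
    (α : GpdSetAction 𝒢 X) (β : GpdSetAction 𝒦 X)
    (hsplitα : α.Split) (hsplitβ : β.Split) (hc : GKCompat α β)
    (hff : β.FullyFaithful)
    -- `λ` is the induced `𝒢`-action on the orbit set `O^𝒦`
    (lam : GpdSetAction 𝒢 (OrbT β))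
    (hlam₁ : ∀ g, lam.car g = {o : OrbT β | ∃ x ∈ α.car g, orbit β x = (o : Set X)})
    (hlam₂ : ∀ g, ∀ x ∈ α.car (𝒢.inv g), lam.act g (orbMap β x) = orbMap β (α.act g x)) :
    SmashDuality k α β 𝒜 lam := by
  refine ⟨psi α β, ?_, ?_, ?_, ?_, ?_, ?_⟩
  · exact fun F hF => psi_isRModEnd 𝒜 hsplitβ hc lam hF
  · exact fun F₁ _ F₂ _ f _ => psi_add α β F₁ F₂ f
  · exact fun c F _ f _ => psi_smul α β c F f
  · exact fun F₁ h₁ F₂ h₂ f hf => psi_mul 𝒜 hsplitβ hc h₁ h₂ hf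
  · exact fun F₁ h₁ F₂ h₂ h => psi_inj 𝒜 hsplitα hsplitβ hc hff h₁ h₂ h
  · exact fun F hF => psi_surj 𝒜 hsplitα hsplitβ hc hff lam hlam₁ F hF

end
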